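/- arXiv:1905.08452 — 13 statements merged into one kernel-verified Lean document; each statement's English description precedes it below -/
import Mathlib

section
/- (Theorem 1, classification) Let A, B be invertible 2×2 complex matrices with ABA = BAB such that A and B have no common eigenvector (i.e., the corresponding representation of B₃ is irreducible). Then there exist a nonzero scalar c ∈ ℂ and an invertible 2×2 matrix P such that either (i) there exist z ∈ ℂ with z ≠ 0, z + 1 ≠ 0, z² + z + 1 ≠ 0 and f, g ∈ ℂ with f·g = z(z²+z+1)/(z+1)², for which c·P⁻¹AP = [[-z, 0], [0, 1]] and c·P⁻¹BP = [[1/(z+1), f], [g, -z²/(z+1)]], or (ii) there exist z ∈ ℂ with z ≠ 0 and e ∈ ℂ for which c·P⁻¹AP = [[1, z], [0, 1]] and c·P⁻¹BP = [[e, z(e-1)²], [-1/z, 2-e]]. -/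
theorem conj_eq_of_mul_eq {A P T : Matrix (Fin 2) (Fin 2) ℂ} (hP : IsUnit P)
    (h : A * P = P * T) : P⁻¹ * A * P = T := by
  rw [Matrix.mul_assoc, h, ← Matrix.mul_assoc,
    Matrix.nonsing_inv_mul _ ((Matrix.isUnit_iff_isUnit_det _).1 hP), Matrix.one_mul]

theorem isUnit_of_fin_two_of_det_ne_zero {a b c d : ℂ} (h : a * d - b * c ≠ 0) :
    IsUnit !![a, b; c, d] := by
  rw [Matrix.isUnit_iff_isUnit_det, Matrix.det_fin_two_of]
  exact h.isUnit

theorem exists_conj_eq_upperTriangular (A : Matrix (Fin 2) (Fin 2) ℂ) :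
    ∃ P : Matrix (Fin 2) (Fin 2) ℂ, IsUnit P ∧
      ∃ l b m : ℂ, P⁻¹ * A * P = !![l, b; 0, m] := by
  obtain ⟨l, hl⟩ := Module.End.exists_eigenvalue (Matrix.toLin' A)
  obtain ⟨v, hv⟩ := hl.exists_hasEigenvector
  have hv1 : A.mulVec v = l • v := by
    simpa [Matrix.toLin'_apply] using hv.apply_eq_smul
  have h0 := congrFun hv1 0
  have h1 := congrFun hv1 1
  simp only [Matrix.mulVec, dotProduct, Fin.sum_univ_two, Pi.smul_apply, smul_eq_mul] at h0 h1
  by_cases hv0 : v 0 = 0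
  · have hv2 : v 1 ≠ 0 := fun h => hv.2 (by ext i; fin_cases i <;> simp [hv0, h])
    have hP : IsUnit !![0, 1; v 1, 0] := isUnit_of_fin_two_of_det_ne_zero (by simpa using hv2)
    refine ⟨_, hP, l, A 1 0 / v 1, A 0 0, conj_eq_of_mul_eq hP ?_⟩
    ext i j
    fin_cases i <;> fin_cases j <;> simp [Matrix.mul_apply, Fin.sum_univ_two, -mul_eq_zero] <;>
      first | (field_simp; done) | linear_combination h0 - (A 0 0 - l) * hv0 |
        linear_combination h1 - A 1 0 * hv0
  · have hP : IsUnit !![v 0, 0; v 1, 1] := isUnit_of_fin_two_of_det_ne_zero (by simpa using hv0)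
    refine ⟨_, hP, l, A 0 1 / v 0, A 1 1 - v 1 * (A 0 1 / v 0), conj_eq_of_mul_eq hP ?_⟩
    ext i j
    fin_cases i <;> fin_cases j <;> simp [Matrix.mul_apply, Fin.sum_univ_two] <;>
      first | (field_simp; done) | linear_combination h0 | linear_combination h1

theorem exists_conj_eq_diagonal_or_jordan (A : Matrix (Fin 2) (Fin 2) ℂ) :
    ∃ P : Matrix (Fin 2) (Fin 2) ℂ, IsUnit P ∧ ∃ l m : ℂ,
      (l ≠ m ∧ P⁻¹ * A * P = !![l, 0; 0, m]) ∨ P⁻¹ * A * P = !![m, l; 0, m] := by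
  obtain ⟨P, hP, l, b, m, h⟩ := exists_conj_eq_upperTriangular A
  by_cases hlm : l = m
  · subst hlm
    exact ⟨P, hP, b, l, Or.inr h⟩
  · have hQ : IsUnit !![1, b; 0, m - l] :=
      isUnit_of_fin_two_of_det_ne_zero (by simpa [sub_eq_zero] using Ne.symm hlm)
    refine ⟨P * !![1, b; 0, m - l], hP.mul hQ, l, m, Or.inl ⟨hlm, ?_⟩⟩
    rw [Matrix.mul_inv_rev]
    have key := conj_eq_of_mul_eq (A := P⁻¹ * A * P) (T := !![l, 0; 0, m]) hQ (by
      rw [h]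
      ext i j
      fin_cases i <;> fin_cases j <;> simp [Matrix.mul_apply, Fin.sum_univ_two] <;> ring)
    rw [← key]
    simp only [Matrix.mul_assoc]

theorem conj_mul_conj {P : Matrix (Fin 2) (Fin 2) ℂ} (hP : IsUnit P)
    (X Y : Matrix (Fin 2) (Fin 2) ℂ) :
    (P⁻¹ * X * P) * (P⁻¹ * Y * P) = P⁻¹ * (X * Y) * P := by
  have h := Matrix.mul_nonsing_inv_cancel_left P (Y * P) ((Matrix.isUnit_iff_isUnit_det _).1 hP)
  simp only [Matrix.mul_assoc, h]

/-- An eigenvector of `c • (P⁻¹ * X * P)` is carried by `P` to an eigenvector of `X`. -/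
theorem mulVec_eq_smul_of_conj {P X : Matrix (Fin 2) (Fin 2) ℂ} (hP : IsUnit P) {c : ℂ}
    (hc : c ≠ 0) {v : Fin 2 → ℂ} {l : ℂ} (h : (c • (P⁻¹ * X * P)).mulVec v = l • v) :
    X.mulVec (P.mulVec v) = (c⁻¹ * l) • P.mulVec v := by
  have h2 := congrArg (fun w => c⁻¹ • P.mulVec w) h
  simp only [Matrix.smul_mulVec, Matrix.mulVec_smul, smul_smul, inv_mul_cancel₀ hc, one_smul,
    Matrix.mulVec_mulVec] at h2
  rwa [Matrix.mul_assoc, Matrix.mul_nonsing_inv_cancel_left P (X * P)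
    ((Matrix.isUnit_iff_isUnit_det _).1 hP), ← Matrix.mulVec_mulVec] at h2

theorem not_common_eigenvector_conj {A B P : Matrix (Fin 2) (Fin 2) ℂ} (hP : IsUnit P) {c : ℂ}
    (hc : c ≠ 0)
    (hirr : ¬ ∃ v : Fin 2 → ℂ, v ≠ 0 ∧ ∃ l m : ℂ, A.mulVec v = l • v ∧ B.mulVec v = m • v) :
    ¬ ∃ v : Fin 2 → ℂ, v ≠ 0 ∧ ∃ l m : ℂ,
      (c • (P⁻¹ * A * P)).mulVec v = l • v ∧ (c • (P⁻¹ * B * P)).mulVec v = m • v := by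
  rintro ⟨v, hv, l, m, hl, hm⟩
  refine hirr ⟨P.mulVec v, fun h => hv ?_, _, _, mulVec_eq_smul_of_conj hP hc hl,
    mulVec_eq_smul_of_conj hP hc hm⟩
  exact Matrix.mulVec_injective_of_isUnit hP (by simpa using h)

theorem braid_smul_conj {A B P : Matrix (Fin 2) (Fin 2) ℂ} (hP : IsUnit P) (c : ℂ)
    (h : A * B * A = B * A * B) :
    (c • (P⁻¹ * A * P)) * (c • (P⁻¹ * B * P)) * (c • (P⁻¹ * A * P)) =
      (c • (P⁻¹ * B * P)) * (c • (P⁻¹ * A * P)) * (c • (P⁻¹ * B * P)) := by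
  simp only [Matrix.smul_mul, Matrix.mul_smul, conj_mul_conj hP, h]

theorem braid_diagonal {z a f g d : ℂ} (hz : z ≠ 0) (hz1 : z + 1 ≠ 0)
    (hbraid : !![-z, 0; 0, 1] * !![a, f; g, d] * !![-z, 0; 0, 1] =
      !![a, f; g, d] * !![-z, 0; 0, 1] * !![a, f; g, d])
    (hf : f ≠ 0) :
    f * g = z * (z ^ 2 + z + 1) / (z + 1) ^ 2 ∧ a = 1 / (z + 1) ∧ d = -z ^ 2 / (z + 1) := by
  have h00 := congrFun (congrFun hbraid 0) 0
  have h01 := congrFun (congrFun hbraid 0) 1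
  have h11 := congrFun (congrFun hbraid 1) 1
  simp [Matrix.mul_apply, Fin.sum_univ_two] at h00 h01 h11
  have hd : d = z * (a - 1) := mul_left_cancel₀ hf (by linear_combination -h01)
  subst hd
  have ha : a = 1 / (z + 1) := by
    rw [eq_div_iff hz1]
    have : z * (z + 1) * (a * (z + 1) - 1) = 0 := by
      linear_combination z * h00 + h11
    simpa [hz, hz1, sub_eq_zero] using this
  subst ha
  refine ⟨?_, rfl, ?_⟩
  · field_simp at h00 ⊢
    linear_combination -h00
  · field_simp
    ring

theorem braid_jordan {z a f g d : ℂ} (hz : z ≠ 0)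
    (hbraid : !![1, z; 0, 1] * !![a, f; g, d] * !![1, z; 0, 1] =
      !![a, f; g, d] * !![1, z; 0, 1] * !![a, f; g, d])
    (hg : g ≠ 0) :
    f = z * (a - 1) ^ 2 ∧ g = -1 / z ∧ d = 2 - a := by
  have h00 := congrFun (congrFun hbraid 0) 0
  have h01 := congrFun (congrFun hbraid 0) 1
  have h10 := congrFun (congrFun hbraid 1) 0
  simp [Matrix.mul_apply, Fin.sum_univ_two] at h00 h01 h10
  have hd : d = 1 - a - z * g := mul_left_cancel₀ hg (by linear_combination -h10)
  subst hd
  have hdet : a * (1 - a - z * g) - f * g = -(z * g) := by linear_combination h00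
  have hdet1 : a * (1 - a - z * g) - f * g = 1 :=
    mul_left_cancel₀ hz (by linear_combination -h01)
  have hgz : g = -1 / z := by
    rw [eq_div_iff hz]
    linear_combination hdet - hdet1
  subst hgz
  refine ⟨?_, rfl, ?_⟩
  · field_simp at hdet1 ⊢
    linear_combination hdet1
  · field_simp
    ring


theorem upperTriangular_mulVec (a b d : ℂ) :
    !![a, b; 0, d].mulVec ![1, 0] = a • ![1, 0] := by
  ext i
  fin_cases i <;> simp [Matrix.mulVec, dotProduct]

theorem lowerTriangular_mulVec (a c d : ℂ) :
    !![a, 0; c, d].mulVec ![0, 1] = d • ![0, 1] := by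
  ext i
  fin_cases i <;> simp [Matrix.mulVec, dotProduct]

/-- Theorem 1 (classification): any pair of invertible `2×2` complex matrices
`(A, B)` with `ABA = BAB` and no common eigenvector is, up to simultaneous
conjugation and tensoring with a 1-dimensional representation (i.e. scaling by
a nonzero constant `c`), of one of the two forms (i) or (ii). -/
theorem stmt_1 (A B : Matrix (Fin 2) (Fin 2) ℂ)
    (hA : IsUnit A) (hB : IsUnit B)
    (hbraid : A * B * A = B * A * B)
    (hirr : ¬ ∃ v : Fin 2 → ℂ, v ≠ 0 ∧ ∃ l m : ℂ,
      A.mulVec v = l • v ∧ B.mulVec v = m • v) :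
    ∃ (c : ℂ), c ≠ 0 ∧ ∃ P : Matrix (Fin 2) (Fin 2) ℂ, IsUnit P ∧
      ((∃ z f g : ℂ, z ≠ 0 ∧ z + 1 ≠ 0 ∧ z ^ 2 + z + 1 ≠ 0 ∧
          f * g = z * (z ^ 2 + z + 1) / (z + 1) ^ 2 ∧
          c • (P⁻¹ * A * P) = !![-z, 0; 0, 1] ∧
          c • (P⁻¹ * B * P) = !![1 / (z + 1), f; g, -z ^ 2 / (z + 1)]) ∨
        (∃ z e : ℂ, z ≠ 0 ∧
          c • (P⁻¹ * A * P) = !![1, z; 0, 1] ∧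
          c • (P⁻¹ * B * P) = !![e, z * (e - 1) ^ 2; -1 / z, 2 - e])) := by
  obtain ⟨P, hP, l, m, h⟩ := exists_conj_eq_diagonal_or_jordan A
  have hdet : (P⁻¹ * A * P).det ≠ 0 :=
    ((Matrix.isUnit_iff_isUnit_det _).1
      (((Matrix.isUnit_nonsing_inv_iff.2 hP).mul hA).mul hP)).ne_zero
  have hm : m ≠ 0 := by
    rintro rfl
    rcases h with ⟨-, h⟩ | h <;> simp [h] at hdet
  have hc : m⁻¹ ≠ 0 := inv_ne_zero hm
  have hbraid' := braid_smul_conj hP m⁻¹ hbraid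
  have hirr' := not_common_eigenvector_conj hP hc hirr
  refine ⟨m⁻¹, hc, P, hP, ?_⟩
  generalize m⁻¹ • (P⁻¹ * B * P) = B' at hbraid' hirr' ⊢
  obtain ⟨a, f, g, d, rfl⟩ : ∃ a f g d, B' = !![a, f; g, d] := ⟨_, _, _, _, B'.eta_fin_two⟩
  rcases h with ⟨hlm, h⟩ | h
  · have hl : l ≠ 0 := by
      rintro rfl
      simp [h] at hdet
    have hA' : m⁻¹ • (P⁻¹ * A * P) = !![-(-l / m), 0; 0, 1] := by
      rw [h]
      ext i j
      fin_cases i <;> fin_cases j <;> simp [hm] <;> field_simp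
    rw [hA'] at hbraid' hirr' ⊢
    have hz : -l / m ≠ 0 := div_ne_zero (neg_ne_zero.2 hl) hm
    have hz1 : -l / m + 1 ≠ 0 := by
      intro h1
      field_simp at h1
      exact hlm (by linear_combination -h1)
    generalize -l / m = z at hbraid' hirr' hz hz1 ⊢
    have hf : f ≠ 0 := by
      rintro rfl
      exact hirr' ⟨![0, 1], by simp, 1, d,
        lowerTriangular_mulVec _ _ _, lowerTriangular_mulVec _ _ _⟩
    have hg : g ≠ 0 := by
      rintro rfl
      exact hirr' ⟨![1, 0], by simp, -z, a,
        upperTriangular_mulVec _ _ _, upperTriangular_mulVec _ _ _⟩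
    obtain ⟨hfg, rfl, rfl⟩ := braid_diagonal hz hz1 hbraid' hf
    refine Or.inl ⟨z, f, g, hz, hz1, fun h0 => ?_, hfg, rfl, rfl⟩
    rw [h0, mul_zero, zero_div] at hfg
    exact mul_ne_zero hf hg hfg
  · have hA' : m⁻¹ • (P⁻¹ * A * P) = !![1, l / m; 0, 1] := by
      rw [h]
      ext i j
      fin_cases i <;> fin_cases j <;> simp [hm] <;> field_simp
    rw [hA'] at hbraid' hirr' ⊢
    generalize l / m = z at hbraid' hirr' ⊢
    have hz : z ≠ 0 := by
      rintro rfl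
      obtain ⟨k, hk⟩ := Module.End.exists_eigenvalue (Matrix.toLin' !![a, f; g, d])
      obtain ⟨v, hv⟩ := hk.exists_hasEigenvector
      refine hirr' ⟨v, hv.2, 1, k, ?_, by simpa only [Matrix.toLin'_apply] using hv.apply_eq_smul⟩
      rw [← Matrix.one_fin_two, Matrix.one_mulVec, one_smul]
    have hg : g ≠ 0 := by
      rintro rfl
      exact hirr' ⟨![1, 0], by simp, 1, a,
        upperTriangular_mulVec _ _ _, upperTriangular_mulVec _ _ _⟩
    obtain ⟨rfl, rfl, rfl⟩ := braid_jordan hz hbraid' hg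
    exact Or.inr ⟨z, a, hz, rfl, rfl⟩
end

section
/- (Theorem 1(i), verification) Let z, f, g ∈ ℂ with z ≠ 0, z + 1 ≠ 0 and f·g = z(z²+z+1)/(z+1)². Then the 2×2 complex matrices A = [[-z, 0], [0, 1]] and B = [[1/(z+1), f], [g, -z²/(z+1)]] are invertible and satisfy the braid relation ABA = BAB. -/
/-- Theorem 1(i), verification: the matrices of family (i) are invertible and
satisfy the braid relation `ABA = BAB`. -/
theorem stmt_2 (z f g : ℂ) (hz : z ≠ 0) (hz1 : z + 1 ≠ 0)
    (hfg : f * g = z * (z ^ 2 + z + 1) / (z + 1) ^ 2)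
    (A B : Matrix (Fin 2) (Fin 2) ℂ)
    (hA : A = !![-z, 0; 0, 1])
    (hB : B = !![1 / (z + 1), f; g, -z ^ 2 / (z + 1)]) :
    IsUnit A ∧ IsUnit B ∧ A * B * A = B * A * B := by
  have hdetA : A.det = -z := by simp [hA, Matrix.det_fin_two]
  have hdetB : B.det = -z := by
    rw [hB, Matrix.det_fin_two_of, hfg]
    field_simp
    ring
  refine ⟨?_, ?_, ?_⟩
  · rw [Matrix.isUnit_iff_isUnit_det, hdetA]
    exact (neg_ne_zero.mpr hz).isUnit
  · rw [Matrix.isUnit_iff_isUnit_det, hdetB]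
    exact (neg_ne_zero.mpr hz).isUnit
  · have h₁₁ : z ^ 2 * (1 / (z + 1)) = -z * (1 / (z + 1)) ^ 2 + f * g := by
      rw [hfg]
      field_simp
      ring
    have htr : -z * (1 / (z + 1)) + -z ^ 2 / (z + 1) = -z := by
      field_simp
      ring
    have h₂₂ : -z ^ 2 / (z + 1) = -z * (f * g) + (-z ^ 2 / (z + 1)) ^ 2 := by
      rw [hfg]
      field_simp
      ring
    rw [hA, hB]
    simp only [Matrix.mul_fin_two]
    congrm !![?_, ?_; ?_, ?_]
    · linear_combination h₁₁
    · linear_combination -f * htr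
    · linear_combination -g * htr
    · linear_combination h₂₂
end

section
/- (Theorem 1(i), uniqueness of the solution) Let z ∈ ℂ with z ≠ 0, let A = [[-z, 0], [0, 1]], and let B = [[e, f], [g, h]] be an invertible 2×2 complex matrix with f ≠ 0 and g ≠ 0 satisfying ABA = BAB. Then z + 1 ≠ 0, e = 1/(z+1), h = -z²/(z+1), and f·g = z(z²+z+1)/(z+1)². -/
/-- Theorem 1(i), uniqueness of the solution: if `A = [[-z,0],[0,1]]` and
`B = [[e,f],[g,h]]` is invertible with `f ≠ 0`, `g ≠ 0` and `ABA = BAB`, then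
`z + 1 ≠ 0`, `e = 1/(z+1)`, `h = -z²/(z+1)` and `fg = z(z²+z+1)/(z+1)²`. -/
theorem stmt_3 (z e f g h : ℂ) (hz : z ≠ 0)
    (A B : Matrix (Fin 2) (Fin 2) ℂ)
    (hA : A = !![-z, 0; 0, 1])
    (hB : B = !![e, f; g, h])
    (hBunit : IsUnit B) (hf : f ≠ 0) (hg : g ≠ 0)
    (hbraid : A * B * A = B * A * B) :
    z + 1 ≠ 0 ∧ e = 1 / (z + 1) ∧ h = -z ^ 2 / (z + 1) ∧
      f * g = z * (z ^ 2 + z + 1) / (z + 1) ^ 2 := by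
  subst hA hB
  have hdet : e * h - f * g ≠ 0 := by
    simpa [Matrix.isUnit_iff_isUnit_det, Matrix.det_fin_two_of] using hBunit
  have h00 := congrFun (congrFun hbraid 0) 0
  have h01 := congrFun (congrFun hbraid 0) 1
  have h11 := congrFun (congrFun hbraid 1) 1
  simp only [Matrix.mul_apply, Fin.sum_univ_two, Matrix.of_apply, Matrix.cons_val_zero,
    Matrix.cons_val_one, Matrix.cons_val', Matrix.cons_val_fin_one] at h00 h01 h11
  have hh : h = z * (e - 1) := mul_left_cancel₀ hf (by linear_combination -h01)
  have hfg : f * g = z * e * (z + e) := by linear_combination -h00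
  have he : e * (z + 1) ^ 2 = z + 1 := mul_left_cancel₀ hz (by
    rw [hh] at h11
    linear_combination h11 - z * hfg)
  have hz1 : z + 1 ≠ 0 := fun h0 ↦ hdet (by
    rw [hfg, hh]
    linear_combination (-z * e) * h0)
  have he' : e = 1 / (z + 1) := by
    rw [eq_div_iff hz1]
    exact mul_right_cancel₀ hz1 (by linear_combination he)
  refine ⟨hz1, he', ?_, ?_⟩
  · rw [hh, he']
    field_simp
    ring
  · rw [hfg, he']
    field_simp
end

section
/- (Theorem 1(i), irreducibility) Let z, f, g ∈ ℂ with z ≠ 0, z + 1 ≠ 0, z² + z + 1 ≠ 0 and f·g = z(z²+z+1)/(z+1)². Then the matrices A = [[-z, 0], [0, 1]] and B = [[1/(z+1), f], [g, -z²/(z+1)]] have no common eigenvector: there is no nonzero vector v ∈ ℂ² and scalars λ, μ ∈ ℂ with Av = λv and Bv = μv. Hence the corresponding 2-dimensional representation of B₃ is irreducible. -/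
/-- Theorem 1(i), irreducibility: the matrices of family (i) have no common
eigenvector when `z² + z + 1 ≠ 0`. -/
theorem stmt_4 (z f g : ℂ) (hz : z ≠ 0) (hz1 : z + 1 ≠ 0)
    (hz2 : z ^ 2 + z + 1 ≠ 0)
    (hfg : f * g = z * (z ^ 2 + z + 1) / (z + 1) ^ 2)
    (A B : Matrix (Fin 2) (Fin 2) ℂ)
    (hA : A = !![-z, 0; 0, 1])
    (hB : B = !![1 / (z + 1), f; g, -z ^ 2 / (z + 1)]) :
    ¬ ∃ v : Fin 2 → ℂ, v ≠ 0 ∧ ∃ l m : ℂ,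
      A.mulVec v = l • v ∧ B.mulVec v = m • v := by
  rintro ⟨v, hv, l, m, hAv, hBv⟩
  subst hA hB
  have hf_g : f * g ≠ 0 := by
    rw [hfg]
    exact div_ne_zero (mul_ne_zero hz hz2) (pow_ne_zero 2 hz1)
  have hA0 : -z * v 0 = l * v 0 := by
    simpa [Matrix.mulVec, dotProduct, Fin.sum_univ_two] using congrFun hAv 0
  have hA1 : v 1 = l * v 1 := by
    simpa [Matrix.mulVec, dotProduct, Fin.sum_univ_two] using congrFun hAv 1
  have hB0 : 1 / (z + 1) * v 0 + f * v 1 = m * v 0 := by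
    simpa [Matrix.mulVec, dotProduct, Fin.sum_univ_two] using congrFun hBv 0
  have hB1 : g * v 0 + -z ^ 2 / (z + 1) * v 1 = m * v 1 := by
    simpa [Matrix.mulVec, dotProduct, Fin.sum_univ_two] using congrFun hBv 1
  have hprod : v 0 * v 1 = 0 :=
    (mul_eq_zero.mp (by linear_combination -v 1 * hA0 + v 0 * hA1 :
      (z + 1) * (v 0 * v 1) = 0)).resolve_left hz1
  apply hv
  rcases mul_eq_zero.mp hprod with h0 | h1
  · have h1 : v 1 = 0 := by simpa [h0, left_ne_zero_of_mul hf_g] using hB0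
    ext i
    fin_cases i <;> simp [h0, h1]
  · have h0 : v 0 = 0 := by simpa [h1, right_ne_zero_of_mul hf_g] using hB1
    ext i
    fin_cases i <;> simp [h0, h1]
end

section
/- (Theorem 1(ii), verification) Let z, e ∈ ℂ with z ≠ 0. Then the 2×2 complex matrices A = [[1, z], [0, 1]] and B = [[e, z(e-1)²], [-1/z, 2-e]] are invertible and satisfy the braid relation ABA = BAB. -/
/-- Theorem 1(ii), verification: the matrices of family (ii) are invertible
and satisfy the braid relation `ABA = BAB`. -/
theorem stmt_5 (z e : ℂ) (hz : z ≠ 0)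
    (A B : Matrix (Fin 2) (Fin 2) ℂ)
    (hA : A = !![1, z; 0, 1])
    (hB : B = !![e, z * (e - 1) ^ 2; -1 / z, 2 - e]) :
    IsUnit A ∧ IsUnit B ∧ A * B * A = B * A * B := by
  subst hA hB
  refine ⟨?_, ?_, ?_⟩
  · simp [Matrix.isUnit_iff_isUnit_det, Matrix.det_fin_two_of]
  · have hdet : !![e, z * (e - 1) ^ 2; -1 / z, 2 - e].det = 1 := by
      rw [Matrix.det_fin_two_of]
      field_simp
      ring
    rw [Matrix.isUnit_iff_isUnit_det, hdet]
    exact isUnit_one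
  · ext i j
    fin_cases i <;> fin_cases j <;> simp [Matrix.mul_apply, Fin.sum_univ_two] <;>
      field_simp <;> ring
end

section
/- (Theorem 1(ii), uniqueness of the solution) Let z ∈ ℂ with z ≠ 0, let A = [[1, z], [0, 1]], and let B = [[e, f], [g, h]] be an invertible 2×2 complex matrix with g ≠ 0 satisfying ABA = BAB. Then f = z(e-1)², g = -1/z, and h = 2 - e. -/
/-- Theorem 1(ii), uniqueness of the solution: if `A = [[1,z],[0,1]]` and
`B = [[e,f],[g,h]]` is invertible with `g ≠ 0` and `ABA = BAB`, then
`f = z(e-1)²`, `g = -1/z` and `h = 2 - e`. -/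
theorem stmt_6 (z e f g h : ℂ) (hz : z ≠ 0)
    (A B : Matrix (Fin 2) (Fin 2) ℂ)
    (hA : A = !![1, z; 0, 1])
    (hB : B = !![e, f; g, h])
    (hBunit : IsUnit B) (hg : g ≠ 0)
    (hbraid : A * B * A = B * A * B) :
    f = z * (e - 1) ^ 2 ∧ g = -1 / z ∧ h = 2 - e := by
  subst hA hB
  have h00 := congrFun (congrFun hbraid 0) 0
  have h01 := congrFun (congrFun hbraid 0) 1
  have h10 := congrFun (congrFun hbraid 1) 0
  simp only [Matrix.mul_apply, Fin.sum_univ_two, Matrix.of_apply, Matrix.cons_val', Matrix.cons_val_zero,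
    Matrix.cons_val_one, Matrix.cons_val_fin_one] at h00 h01 h10
  have hsum : e + z * g + h = 1 := mul_left_cancel₀ hg (by linear_combination -h10)
  have hfg : f * g = (1 - h) * (1 - e) := by
    linear_combination -h00 + (1 - e) * hsum
  have hdet : e * h - f * g = 1 :=
    mul_left_cancel₀ hz (by linear_combination -h01 + (z - f) * hsum)
  have htrace : h = 2 - e := by linear_combination hdet + hfg
  have hzg : z * g = -1 := by linear_combination hsum - htrace
  refine ⟨?_, ?_, htrace⟩
  · linear_combination f * hzg - z * hfg + z * (1 - e) * htrace
  · rw [eq_div_iff hz]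
    linear_combination hzg
end

section
/- (Theorem 1(ii), irreducibility) Let z, e ∈ ℂ with z ≠ 0. Then the matrices A = [[1, z], [0, 1]] and B = [[e, z(e-1)²], [-1/z, 2-e]] have no common eigenvector: there is no nonzero vector v ∈ ℂ² and scalars λ, μ ∈ ℂ with Av = λv and Bv = μv. Hence the corresponding 2-dimensional representation of B₃ is irreducible. -/
/-- Theorem 1(ii), irreducibility: the matrices of family (ii) have no common
eigenvector. -/
theorem stmt_7 (z e : ℂ) (hz : z ≠ 0)
    (A B : Matrix (Fin 2) (Fin 2) ℂ)
    (hA : A = !![1, z; 0, 1])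
    (hB : B = !![e, z * (e - 1) ^ 2; -1 / z, 2 - e]) :
    ¬ ∃ v : Fin 2 → ℂ, v ≠ 0 ∧ ∃ l m : ℂ,
      A.mulVec v = l • v ∧ B.mulVec v = m • v := by
  rintro ⟨v, hv, l, m, hAv, hBv⟩
  subst hA hB
  have hA₀ : v 0 + z * v 1 = l * v 0 := by
    simpa [Matrix.mulVec, dotProduct, Fin.sum_univ_two] using congrFun hAv 0
  have hA₁ : v 1 = l * v 1 := by
    simpa [Matrix.mulVec, dotProduct, Fin.sum_univ_two] using congrFun hAv 1
  have hB₁ : -1 / z * v 0 + (2 - e) * v 1 = m * v 1 := by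
    simpa [Matrix.mulVec, dotProduct, Fin.sum_univ_two] using congrFun hBv 1
  have hv₁ : v 1 = 0 := by
    by_contra h
    have hl : l = 1 := mul_right_cancel₀ h (by rw [← hA₁, one_mul])
    rw [hl, one_mul, add_eq_left] at hA₀
    exact (mul_ne_zero hz h) hA₀
  have hv₀ : v 0 = 0 := by
    simpa [hv₁, hz] using hB₁
  apply hv
  ext i
  fin_cases i
  · exact hv₀
  · exact hv₁
end

section
/- (Irreducibility of the Burau representation) Let z ∈ ℂ with z ≠ 0 and z² + z + 1 ≠ 0. Then the Burau matrices A = [[-z, 0], [1, 1]] and B = [[1, z], [0, -z]] have no common eigenvector: there is no nonzero vector v ∈ ℂ² and scalars λ, μ ∈ ℂ with Av = λv and Bv = μv. -/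
/-- Irreducibility of the Burau representation: if `z ≠ 0` and
`z² + z + 1 ≠ 0`, the Burau matrices have no common eigenvector. -/
theorem stmt_9 (z : ℂ) (hz : z ≠ 0) (hz2 : z ^ 2 + z + 1 ≠ 0)
    (A B : Matrix (Fin 2) (Fin 2) ℂ)
    (hA : A = !![-z, 0; 1, 1])
    (hB : B = !![1, z; 0, -z]) :
    ¬ ∃ v : Fin 2 → ℂ, v ≠ 0 ∧ ∃ l m : ℂ,
      A.mulVec v = l • v ∧ B.mulVec v = m • v := by
  subst hA hB
  rintro ⟨v, hv, l, m, hl, hm⟩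
  have hl₀ : -z * v 0 = l * v 0 := by
    simpa [Matrix.mulVec, dotProduct, Fin.sum_univ_two] using congrFun hl 0
  have hl₁ : v 0 + v 1 = l * v 1 := by
    simpa [Matrix.mulVec, dotProduct, Fin.sum_univ_two] using congrFun hl 1
  have hm₀ : v 0 + z * v 1 = m * v 0 := by
    simpa [Matrix.mulVec, dotProduct, Fin.sum_univ_two] using congrFun hm 0
  have hm₁ : -z * v 1 = m * v 1 := by
    simpa [Matrix.mulVec, dotProduct, Fin.sum_univ_two] using congrFun hm 1
  have h₁ : v 1 ≠ 0 := by
    intro h₁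
    have h₀ : v 0 = 0 := by simpa [h₁] using hl₁
    exact hv (by ext i; fin_cases i <;> simp [h₀, h₁])
  have h₀ : v 0 ≠ 0 := by
    intro h₀
    simp [h₀, hz, h₁] at hm₀
  obtain rfl : -z = l := mul_right_cancel₀ h₀ hl₀
  obtain rfl : -z = m := mul_right_cancel₀ h₁ hm₁
  refine mul_ne_zero hz2 h₁ ?_
  linear_combination (1 + z) * hl₁ - hm₀
end

section
/- (Proposition 3, diagonalizing conjugation) Let z ∈ ℂ with z ≠ 0 and z + 1 ≠ 0, let A = [[-z, 0], [1, 1]], B = [[1, z], [0, -z]], and let P be the 4×4 matrix [[0, 0, 0, (z+1)²], [0, -(z+1), -1, -(z+1)], [0, 0, 1, -(z+1)], [1, 1, 0, 1]]. Then P is invertible, P⁻¹(A ⊗ A)P = diag(1, -z, -z, z²), and P⁻¹(B ⊗ B)P equals the 4×4 matrix whose rows are (z⁴/(z+1)², z²(z²+z+1)/(z+1)², 0, (z²+z+1)²/(z+1)²), (2z³/(z+1)², z(z²+1)/(z+1)², 0, -2(z²+z+1)/(z+1)²), (-z³/(z+1), -z(z²+z+1)/(z+1), -z, (z²+z+1)/(z+1)),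 and (z²/(z+1)², -z/(z+1)², 0, 1/(z+1)²). -/
open Kronecker

/-- Proposition 3 (diagonalizing conjugation): the given `4×4` matrix `P` is
invertible and conjugates the Kronecker squares of the Burau matrices
(written as `4×4` matrices via the standard row-major indexing of
`Fin 2 × Fin 2`) to the stated forms. -/
theorem stmt_12 (z : ℂ) (hz : z ≠ 0) (hz1 : z + 1 ≠ 0)
    (A B : Matrix (Fin 2) (Fin 2) ℂ)
    (hA : A = !![-z, 0; 1, 1])
    (hB : B = !![1, z; 0, -z])
    (AA BB : Matrix (Fin 4) (Fin 4) ℂ)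
    (hAA : AA = Matrix.reindex finProdFinEquiv finProdFinEquiv (A ⊗ₖ A))
    (hBB : BB = Matrix.reindex finProdFinEquiv finProdFinEquiv (B ⊗ₖ B))
    (P : Matrix (Fin 4) (Fin 4) ℂ)
    (hP : P = !![0, 0, 0, (z + 1) ^ 2;
                 0, -(z + 1), -1, -(z + 1);
                 0, 0, 1, -(z + 1);
                 1, 1, 0, 1]) :
    IsUnit P ∧
    P⁻¹ * AA * P = Matrix.diagonal ![1, -z, -z, z ^ 2] ∧
    P⁻¹ * BB * P =
      !![z ^ 4 / (z + 1) ^ 2, z ^ 2 * (z ^ 2 + z + 1) / (z + 1) ^ 2, 0,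
           (z ^ 2 + z + 1) ^ 2 / (z + 1) ^ 2;
         2 * z ^ 3 / (z + 1) ^ 2, z * (z ^ 2 + 1) / (z + 1) ^ 2, 0,
           -2 * (z ^ 2 + z + 1) / (z + 1) ^ 2;
         -z ^ 3 / (z + 1), -z * (z ^ 2 + z + 1) / (z + 1), -z,
           (z ^ 2 + z + 1) / (z + 1);
         z ^ 2 / (z + 1) ^ 2, -z / (z + 1) ^ 2, 0, 1 / (z + 1) ^ 2] := by
  have hdet : IsUnit P.det := by
    have h : P.det = (z + 1) ^ 3 := by
      subst hP
      simp [Matrix.det_succ_row_zero, Fin.sum_univ_succ, Fin.succAbove]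
      ring
    rw [h]
    exact (pow_ne_zero 3 hz1).isUnit
  have conj_eq {X Y : Matrix (Fin 4) (Fin 4) ℂ} (h : X * P = P * Y) : P⁻¹ * X * P = Y := by
    rw [Matrix.mul_assoc, h, Matrix.nonsing_inv_mul_cancel_left _ _ hdet]
  have hAA' : AA = !![z ^ 2, 0, 0, 0; -z, -z, 0, 0; -z, 0, -z, 0; 1, 1, 1, 1] := by
    subst hAA hA
    ext i j
    fin_cases i <;> fin_cases j <;>
      simp [finProdFinEquiv, Fin.divNat, Fin.modNat, pow_two]
  have hBB' : BB = !![1, z, z, z ^ 2; 0, -z, 0, -z ^ 2; 0, 0, -z, -z ^ 2; 0, 0, 0, z ^ 2] := by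
    subst hBB hB
    ext i j
    fin_cases i <;> fin_cases j <;>
      simp [finProdFinEquiv, Fin.divNat, Fin.modNat, pow_two]
  refine ⟨(Matrix.isUnit_iff_isUnit_det P).2 hdet, conj_eq ?_, conj_eq ?_⟩
  · subst hAA' hP
    ext i j
    fin_cases i <;> fin_cases j <;>
      simp [Matrix.mul_apply, Fin.sum_univ_succ] <;> ring
  · subst hBB' hP
    ext i j
    fin_cases i <;> fin_cases j <;>
      simp [Matrix.mul_apply, Fin.sum_univ_succ] <;> field_simp <;> ring
end

section
/- (The representation μ(z) satisfies the braid relation) Let z ∈ ℂ with z ≠ 0 and z + 1 ≠ 0. Let C = diag(1, -z, z²) and let D be the 3×3 matrix with rows (z⁴/(z+1)², z²(z²+z+1)/(z+1)², (z²+z+1)²/(z+1)²), (2z³/(z+1)², z(z²+1)/(z+1)², -2(z²+z+1)/(z+1)²), and (z²/(z+1)², -z/(z+1)², 1/(z+1)²). Then C and D are invertible and CDC = DCD, so σ₁ ↦ C, σ₂ ↦ D defines a 3-dimensional complex representation μ(z) of B₃. -/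
/-- The matrices `C = diag(1, -z, z²)` and `D` of `μ(z)` are invertible and
satisfy the braid relation `CDC = DCD`, so they define a 3-dimensional
complex representation `μ(z)` of `B₃`. -/
theorem stmt_13 (z : ℂ) (hz : z ≠ 0) (hz1 : z + 1 ≠ 0)
    (C D : Matrix (Fin 3) (Fin 3) ℂ)
    (hC : C = Matrix.diagonal ![1, -z, z ^ 2])
    (hD : D = !![z ^ 4 / (z + 1) ^ 2, z ^ 2 * (z ^ 2 + z + 1) / (z + 1) ^ 2,
                   (z ^ 2 + z + 1) ^ 2 / (z + 1) ^ 2;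
                 2 * z ^ 3 / (z + 1) ^ 2, z * (z ^ 2 + 1) / (z + 1) ^ 2,
                   -2 * (z ^ 2 + z + 1) / (z + 1) ^ 2;
                 z ^ 2 / (z + 1) ^ 2, -z / (z + 1) ^ 2, 1 / (z + 1) ^ 2]) :
    IsUnit C ∧ IsUnit D ∧ C * D * C = D * C * D := by
  have hdet : D.det = -z ^ 3 := by
    rw [hD, Matrix.det_fin_three]
    simp
    field_simp
    ring
  refine ⟨?_, ?_, ?_⟩
  · rw [Matrix.isUnit_iff_isUnit_det, hC, Matrix.det_diagonal]
    simp [Fin.prod_univ_three, hz]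
  · rw [Matrix.isUnit_iff_isUnit_det, hdet]
    simp [hz]
  · rw [hC, hD]
    ext i j
    fin_cases i <;> fin_cases j <;>
      simp [Matrix.mul_apply, Fin.sum_univ_three,
        Matrix.diagonal_apply, -Matrix.cons_mul] <;>
      field_simp <;> ring
end

section
/- (Proposition 3, irreducibility of μ(z)) Let z ∈ ℂ with z ≠ 0, z + 1 ≠ 0, and z³ ≠ 1. Let C = diag(1, -z, z²) and let D be the 3×3 matrix with rows (z⁴/(z+1)², z²(z²+z+1)/(z+1)², (z²+z+1)²/(z+1)²), (2z³/(z+1)², z(z²+1)/(z+1)², -2(z²+z+1)/(z+1)²), (z²/(z+1)², -z/(z+1)², 1/(z+1)²). Then C and D have no common eigenvector: there is no nonzero vector v ∈ ℂ³ and scalars λ, μ ∈ ℂ with Cv = λv and Dv = μv. Equivalently, no 1-dimensional subspace of ℂ³ is invariant under both C and D. -/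
/-- Proposition 3, irreducibility of `μ(z)`: if `z ≠ 0`, `z + 1 ≠ 0` and
`z³ ≠ 1`, the matrices `C` and `D` of `μ(z)` have no common eigenvector. -/
theorem stmt_15 (z : ℂ) (hz : z ≠ 0) (hz1 : z + 1 ≠ 0) (hz3 : z ^ 3 ≠ 1)
    (C D : Matrix (Fin 3) (Fin 3) ℂ)
    (hC : C = Matrix.diagonal ![1, -z, z ^ 2])
    (hD : D = !![z ^ 4 / (z + 1) ^ 2, z ^ 2 * (z ^ 2 + z + 1) / (z + 1) ^ 2,
                   (z ^ 2 + z + 1) ^ 2 / (z + 1) ^ 2;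
                 2 * z ^ 3 / (z + 1) ^ 2, z * (z ^ 2 + 1) / (z + 1) ^ 2,
                   -2 * (z ^ 2 + z + 1) / (z + 1) ^ 2;
                 z ^ 2 / (z + 1) ^ 2, -z / (z + 1) ^ 2, 1 / (z + 1) ^ 2]) :
    ¬ ∃ v : Fin 3 → ℂ, v ≠ 0 ∧ ∃ l m : ℂ,
      C.mulVec v = l • v ∧ D.mulVec v = m • v := by
  rintro ⟨v, hv, l, m, h, hm⟩
  subst hC hD
  have hone : z ≠ 1 := by rintro rfl; simp at hz3
  have hq : z ^ 2 + z + 1 ≠ 0 := fun hq => hz3 (by linear_combination (z - 1) * hq)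
  have h₀ : (1 - l) * v 0 = 0 := by
    have := congrFun h 0
    simp [Matrix.mulVec_diagonal, -mul_eq_mul_right_iff] at this
    linear_combination this
  have h₁ : (-z - l) * v 1 = 0 := by
    have := congrFun h 1
    simp [Matrix.mulVec_diagonal, -mul_eq_mul_right_iff] at this
    linear_combination this
  have h₂ : (z ^ 2 - l) * v 2 = 0 := by
    have := congrFun h 2
    simp [Matrix.mulVec_diagonal, -mul_eq_mul_right_iff] at this
    linear_combination this
  -- The eigenvalues of `C` are distinct, so at most one coordinate of `v` is nonzero.
  have h₀₁ : v 0 = 0 ∨ v 1 = 0 := by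
    have : (1 + z) * (v 0 * v 1) = 0 := by linear_combination v 1 * h₀ - v 0 * h₁
    simpa [add_comm, hz1] using this
  have h₁₂ : v 1 = 0 ∨ v 2 = 0 := by
    have : z * (z + 1) * (v 1 * v 2) = 0 := by linear_combination v 1 * h₂ - v 2 * h₁
    simpa [hz, hz1] using this
  have h₀₂ : v 0 = 0 ∨ v 2 = 0 := by
    have : (z - 1) * (z + 1) * (v 0 * v 2) = 0 := by linear_combination v 0 * h₂ - v 2 * h₀
    simpa [sub_eq_zero, hone, hz1] using this
  -- Every column of `D` has a nonzero off-diagonal entry.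
  have d₀ := congrFun hm 0
  have d₂ := congrFun hm 2
  simp [Matrix.mulVec, dotProduct, Fin.sum_univ_three] at d₀ d₂
  by_cases e₀ : v 0 = 0
  · by_cases e₁ : v 1 = 0
    · have e₂ : v 2 = 0 := by simpa [e₀, e₁, hq, hz1] using d₀
      exact hv (by ext i; fin_cases i <;> simp [e₀, e₁, e₂])
    · have e₂ := h₁₂.resolve_left e₁
      simp [e₀, e₁, e₂, hz, hz1] at d₂
  · have e₁ := h₀₁.resolve_left e₀
    have e₂ := h₀₂.resolve_left e₀
    simp [e₀, e₁, e₂, hz, hz1] at d₂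
end

section
/- (Remark 5, braid relation for the Pascal-pattern matrices) Let z ∈ ℂ with z ≠ 0, and let C' = [[z², 0, 0], [-z, -z, 0], [1, 2, 1]] and D' = [[1, 2z, z²], [0, -z, -z²], [0, 0, z²]]. Then C' and D' are invertible and C'D'C' = D'C'D', so they define a 3-dimensional complex representation of B₃. -/
/-- Remark 5: the Pascal-pattern matrices `C'` and `D'` are invertible and
satisfy the braid relation `C'D'C' = D'C'D'`, hence define a 3-dimensional
complex representation of `B₃`. -/
theorem stmt_18 (z : ℂ) (hz : z ≠ 0)
    (C' D' : Matrix (Fin 3) (Fin 3) ℂ)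
    (hC : C' = !![z ^ 2, 0, 0; -z, -z, 0; 1, 2, 1])
    (hD : D' = !![1, 2 * z, z ^ 2; 0, -z, -z ^ 2; 0, 0, z ^ 2]) :
    IsUnit C' ∧ IsUnit D' ∧ C' * D' * C' = D' * C' * D' := by
  subst hC hD
  refine ⟨?_, ?_, ?_⟩
  · rw [Matrix.isUnit_iff_isUnit_det]
    simp [Matrix.det_fin_three, hz]
  · rw [Matrix.isUnit_iff_isUnit_det]
    simp [Matrix.det_fin_three, hz]
  · ext i j
    fin_cases i <;> fin_cases j <;>
      simp [Matrix.mul_apply, Fin.sum_univ_three] <;> ring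
end

section
/- (Remark 5, isomorphism of μ(z) with the Pascal-pattern representation) Let z ∈ ℂ with z ≠ 0 and z + 1 ≠ 0. Let C = diag(1, -z, z²) and let D be the 3×3 matrix with rows (z⁴/(z+1)², z²(z²+z+1)/(z+1)², (z²+z+1)²/(z+1)²), (2z³/(z+1)², z(z²+1)/(z+1)², -2(z²+z+1)/(z+1)²), (z²/(z+1)², -z/(z+1)², 1/(z+1)²). Then there exists an invertible 3×3 complex matrix Q such that Q⁻¹CQ = [[z², 0, 0], [-z, -z, 0], [1, 2, 1]] and Q⁻¹DQ = [[1, 2z, z²], [0, -z, -z²], [0, 0, z²]]. -/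
/-- Remark 5: the representation `μ(z)` (given by `C` and `D`) is isomorphic
to the Pascal-pattern representation: there is an invertible matrix `Q` with
`Q⁻¹CQ = [[z²,0,0],[-z,-z,0],[1,2,1]]` and
`Q⁻¹DQ = [[1,2z,z²],[0,-z,-z²],[0,0,z²]]`. -/
theorem stmt_19 (z : ℂ) (hz : z ≠ 0) (hz1 : z + 1 ≠ 0)
    (C D : Matrix (Fin 3) (Fin 3) ℂ)
    (hC : C = Matrix.diagonal ![1, -z, z ^ 2])
    (hD : D = !![z ^ 4 / (z + 1) ^ 2, z ^ 2 * (z ^ 2 + z + 1) / (z + 1) ^ 2,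
                   (z ^ 2 + z + 1) ^ 2 / (z + 1) ^ 2;
                 2 * z ^ 3 / (z + 1) ^ 2, z * (z ^ 2 + 1) / (z + 1) ^ 2,
                   -2 * (z ^ 2 + z + 1) / (z + 1) ^ 2;
                 z ^ 2 / (z + 1) ^ 2, -z / (z + 1) ^ 2, 1 / (z + 1) ^ 2]) :
    ∃ Q : Matrix (Fin 3) (Fin 3) ℂ, IsUnit Q ∧
      Q⁻¹ * C * Q = !![z ^ 2, 0, 0; -z, -z, 0; 1, 2, 1] ∧
      Q⁻¹ * D * Q = !![1, 2 * z, z ^ 2; 0, -z, -z ^ 2; 0, 0, z ^ 2] := by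
  have hdet : IsUnit (!![0, 0, (1 + z) ^ 2; 0, -(1 + z) / 2, -(1 + z); 1, 1, 1] :
      Matrix (Fin 3) (Fin 3) ℂ).det := by
    have h : (1 + z) ^ 3 ≠ 0 := pow_ne_zero 3 (by rwa [add_comm])
    rw [isUnit_iff_ne_zero, Matrix.det_fin_three]
    simp only [Matrix.of_apply, Matrix.cons_val', Matrix.cons_val]
    intro h0
    exact h (by linear_combination 2 * h0)
  set P : Matrix (Fin 3) (Fin 3) ℂ :=
    !![0, 0, (1 + z) ^ 2; 0, -(1 + z) / 2, -(1 + z); 1, 1, 1] with hP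
  refine ⟨P⁻¹, ?_, ?_, ?_⟩
  · rw [Matrix.isUnit_nonsing_inv_iff, Matrix.isUnit_iff_isUnit_det]
    exact hdet
  · rw [Matrix.nonsing_inv_nonsing_inv P hdet]
    suffices h : P * C = !![z ^ 2, 0, 0; -z, -z, 0; 1, 2, 1] * P by
      rw [h, Matrix.mul_nonsing_inv_cancel_right P _ hdet]
    rw [hC, hP]
    ext i j
    fin_cases i <;> fin_cases j <;>
      simp [Matrix.mul_apply, Fin.sum_univ_three, Matrix.diagonal_apply] <;> ring
  · rw [Matrix.nonsing_inv_nonsing_inv P hdet]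
    suffices h : P * D = !![1, 2 * z, z ^ 2; 0, -z, -z ^ 2; 0, 0, z ^ 2] * P by
      rw [h, Matrix.mul_nonsing_inv_cancel_right P _ hdet]
    have hz1' : 1 + z ≠ 0 := by rwa [add_comm]
    rw [hD, hP]
    ext i j
    fin_cases i <;> fin_cases j <;>
      simp [Matrix.mul_apply, Fin.sum_univ_three] <;> field_simp <;> ring
end
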